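/- arXiv:2506.14812 — 3 statements merged into one kernel-verified Lean document; each statement's English description precedes it below -/
import Mathlib

section
/- Suppose each u^(ℓ) : ℝ^d → ℝ is continuous and let u_PoU(x) = ∑_{q=1}^L χ^(q)(x) u^(q)(x). Then for every index ℓ and every x ∈ closure(Ω^(ℓ)), u_PoU(y) tends to u^(ℓ)(x) as y tends to x within Ω^(ℓ). Consequently, for any two indices ℓ ≠ q and any x ∈ ∂Ω^(ℓ) ∩ ∂Ω^(q), the jump of u_PoU across the interface, defined as the limit of u_PoU at x from within Ω^(ℓ) minus the limit of u_PoU at x from within Ω^(q), equals u^(ℓ)(x) − u^(q)(x). -/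
open Classical in

/-- The partition-of-unity function `χ^(ℓ)`: it equals `1` on `Ω^(ℓ)`,
`1/(|Λ^(ℓ)(x)| + 1)` on the boundary `∂Ω^(ℓ) = closure(Ω^(ℓ)) \ Ω^(ℓ)`, where
`Λ^(ℓ)(x) = {q ≠ ℓ : x ∈ closure(Ω^(q))}`, and `0` otherwise. -/
noncomputable def chi {d L : ℕ} (Ω : Fin L → Set (EuclideanSpace ℝ (Fin d))) (ℓ : Fin L)
    (x : EuclideanSpace ℝ (Fin d)) : ℝ :=
  if x ∈ Ω ℓ then 1
  else if x ∈ closure (Ω ℓ) then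
    1 / (Nat.card {q : Fin L // q ≠ ℓ ∧ x ∈ closure (Ω q)} + 1)
  else 0

/-- On `Ω^(ℓ)`, the function `χ^(q)` is the Kronecker delta. -/
theorem chi_eq_ite_of_mem {d L : ℕ} {Ω : Fin L → Set (EuclideanSpace ℝ (Fin d))}
    (hdisj : ∀ q ℓ, q ≠ ℓ → Ω q ∩ closure (Ω ℓ) = ∅) {ℓ : Fin L}
    {y : EuclideanSpace ℝ (Fin d)} (hy : y ∈ Ω ℓ) (q : Fin L) :
    chi Ω q y = if q = ℓ then 1 else 0 := by
  split_ifs with h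
  · subst h
    exact if_pos hy
  · have hcl : y ∉ closure (Ω q) := fun hyq =>
      Set.eq_empty_iff_forall_notMem.mp (hdisj ℓ q (Ne.symm h)) y ⟨hy, hyq⟩
    rw [chi, if_neg fun hyq => hcl (subset_closure hyq), if_neg hcl]

/-- On `Ω^(ℓ)`, the blended function coincides with `u^(ℓ)`. -/
theorem sum_chi_mul_eq_of_mem {d L : ℕ} {Ω : Fin L → Set (EuclideanSpace ℝ (Fin d))}
    (hdisj : ∀ q ℓ, q ≠ ℓ → Ω q ∩ closure (Ω ℓ) = ∅)
    (u : Fin L → EuclideanSpace ℝ (Fin d) → ℝ) {ℓ : Fin L}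
    {y : EuclideanSpace ℝ (Fin d)} (hy : y ∈ Ω ℓ) :
    ∑ q, chi Ω q y * u q y = u ℓ y := by
  simp [chi_eq_ite_of_mem hdisj hy]

/-- Suppose each `u^(ℓ) : ℝ^d → ℝ` is continuous and let
`u_PoU(x) = ∑_q χ^(q)(x) u^(q)(x)`. Then for every index `ℓ` and every
`x ∈ closure(Ω^(ℓ))`, `u_PoU(y)` tends to `u^(ℓ)(x)` as `y → x` within `Ω^(ℓ)`.
Consequently, for any two indices `ℓ ≠ q` and any `x ∈ ∂Ω^(ℓ) ∩ ∂Ω^(q)`, the jump of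
`u_PoU` across the interface — the limit of `u_PoU` at `x` from within `Ω^(ℓ)` minus the
limit from within `Ω^(q)` — equals `u^(ℓ)(x) − u^(q)(x)`. -/
theorem uPoU_limit_and_jump {d L : ℕ} (Ω : Fin L → Set (EuclideanSpace ℝ (Fin d)))
    (hopen : ∀ ℓ, IsOpen (Ω ℓ))
    (hdisj : ∀ q ℓ, q ≠ ℓ → Ω q ∩ closure (Ω ℓ) = ∅)
    (u : Fin L → EuclideanSpace ℝ (Fin d) → ℝ) (hu : ∀ ℓ, Continuous (u ℓ))
    (uPoU : EuclideanSpace ℝ (Fin d) → ℝ)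
    (huPoU : uPoU = fun x => ∑ q, chi Ω q x * u q x) :
    (∀ ℓ : Fin L, ∀ x ∈ closure (Ω ℓ),
      Filter.Tendsto uPoU (nhdsWithin x (Ω ℓ)) (nhds (u ℓ x))) ∧
      ∀ ℓ q : Fin L, ℓ ≠ q →
        ∀ x ∈ (closure (Ω ℓ) \ Ω ℓ) ∩ (closure (Ω q) \ Ω q),
          ∀ aℓ aq : ℝ,
            Filter.Tendsto uPoU (nhdsWithin x (Ω ℓ)) (nhds aℓ) →
            Filter.Tendsto uPoU (nhdsWithin x (Ω q)) (nhds aq) →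
            aℓ - aq = u ℓ x - u q x := by
  have hlim : ∀ ℓ x, Filter.Tendsto uPoU (nhdsWithin x (Ω ℓ)) (nhds (u ℓ x)) := by
    intro ℓ x
    refine ((hu ℓ).continuousWithinAt (s := Ω ℓ) (x := x)).tendsto.congr' ?_
    filter_upwards [self_mem_nhdsWithin] with y hy
    rw [huPoU]
    exact (sum_chi_mul_eq_of_mem hdisj u hy).symm
  refine ⟨fun ℓ x _ => hlim ℓ x, ?_⟩
  rintro ℓ q - x ⟨⟨hxℓ, -⟩, ⟨hxq, -⟩⟩ aℓ aq haℓ haq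
  have := mem_closure_iff_nhdsWithin_neBot.mp hxℓ
  have := mem_closure_iff_nhdsWithin_neBot.mp hxq
  rw [tendsto_nhds_unique haℓ (hlim ℓ x), tendsto_nhds_unique haq (hlim q x)]
end

section
/- The function u is a weak solution of the Darcy equation −∇·(κ∇u) = f on Ω: u is continuously differentiable on ℝ² with gradient ∇u(x,y) = (2x, 0) for x ≤ 1/2 and ∇u(x,y) = (2 − 2x, 0) for x > 1/2, and for every smooth function v : ℝ² → ℝ with compact support contained in Ω, ∫_Ω κ(x,y) ∇u(x,y)·∇v(x,y) d(x,y) = ∫_Ω f(x,y) v(x,y) d(x,y). -/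
open MeasureTheory

/-- The domain `Ω = (0,1)²`. -/
def OmegaSet : Set (ℝ × ℝ) := Set.Ioo (0 : ℝ) 1 ×ˢ Set.Ioo (0 : ℝ) 1

/-- The permeability `κ(x,y) = 1 + x² + y²`. -/
def kappa (x y : ℝ) : ℝ := 1 + x ^ 2 + y ^ 2

/-- The exact weak solution `u(x,y) = x²` if `x ≤ 1/2`, `u(x,y) = −x² + 2x − 1/2` if `x > 1/2`. -/
noncomputable def uu (x y : ℝ) : ℝ := if x ≤ 1/2 then x ^ 2 else -x ^ 2 + 2 * x - 1/2

/-- The source `f(x,y) = −2 − 6x² − 2y²` if `x ≤ 1/2`, `f(x,y) = 6x² + 2y² − 4x + 2` if `x > 1/2`. -/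
noncomputable def ff (x y : ℝ) : ℝ :=
  if x ≤ 1/2 then -2 - 6 * x ^ 2 - 2 * y ^ 2 else 6 * x ^ 2 + 2 * y ^ 2 - 4 * x + 2

/-- The `x`-derivative of `uu`, as a function of `x`. -/
noncomputable def uuSlope (x : ℝ) : ℝ := if x ≤ 1/2 then 2 * x else 2 - 2 * x

lemma continuous_uuSlope : Continuous uuSlope := by
  unfold uuSlope
  refine Continuous.if_le (by fun_prop) (by fun_prop) continuous_id continuous_const ?_
  rintro x rfl
  norm_num

lemma continuous_uu_left (y : ℝ) : Continuous fun x => uu x y := by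
  unfold uu
  refine Continuous.if_le (by fun_prop) (by fun_prop) continuous_id continuous_const ?_
  rintro x rfl
  norm_num

lemma hasDerivAt_ite_le {a x l' r' : ℝ} {l r : ℝ → ℝ} (hx : x ≠ a)
    (hl : HasDerivAt l l' x) (hr : HasDerivAt r r' x) :
    HasDerivAt (fun t => if t ≤ a then l t else r t) (if x ≤ a then l' else r') x := by
  rcases hx.lt_or_gt with h | h
  · rw [if_pos h.le]
    refine hl.congr_of_eventuallyEq ?_
    filter_upwards [Iio_mem_nhds h] with t ht using if_pos (le_of_lt ht)
  · rw [if_neg h.not_ge]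
    refine hr.congr_of_eventuallyEq ?_
    filter_upwards [Ioi_mem_nhds h] with t ht using if_neg (not_le_of_gt ht)

lemma hasDerivAt_uu_left (x y : ℝ) : HasDerivAt (fun t => uu t y) (uuSlope x) x := by
  refine hasDerivAt_of_hasDerivAt_of_ne' (x := 1/2) (fun t ht => ?_)
    (continuous_uu_left y).continuousAt continuous_uuSlope.continuousAt x
  refine hasDerivAt_ite_le ht ?_ ?_
  · simpa using hasDerivAt_pow 2 t
  · exact (((hasDerivAt_pow 2 t).neg.add ((hasDerivAt_id t).const_mul 2)).sub_const
      (1/2)).congr_deriv (by norm_num; ring)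

lemma hasFDerivAt_uu (p : ℝ × ℝ) :
    HasFDerivAt (fun q : ℝ × ℝ => uu q.1 q.2) (uuSlope p.1 • ContinuousLinearMap.fst ℝ ℝ ℝ) p :=
  (hasDerivAt_uu_left p.1 0).comp_hasFDerivAt p hasFDerivAt_fst

lemma contDiff_uu : ContDiff ℝ 1 fun p : ℝ × ℝ => uu p.1 p.2 := by
  rw [contDiff_one_iff_hasFDerivAt]
  exact ⟨_, (continuous_uuSlope.comp continuous_fst).smul continuous_const, hasFDerivAt_uu⟩

/-- Minus the source is the `x`-derivative of the flux `κ ∂ₓu`, off the interface. -/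
lemma hasDerivAt_flux {x : ℝ} (hx : x ≠ 1/2) (y : ℝ) :
    HasDerivAt (fun t => kappa t y * uuSlope t) (-ff x y) x := by
  have hκ : HasDerivAt (fun t => kappa t y) (2 * x) x := by
    simpa [kappa] using ((hasDerivAt_pow 2 x).const_add 1).add_const (y ^ 2)
  have hs : HasDerivAt uuSlope (if x ≤ 1/2 then 2 else -2) x :=
    hasDerivAt_ite_le hx (by simpa using (hasDerivAt_id x).const_mul 2)
      (by simpa using ((hasDerivAt_id x).const_mul 2).const_sub 2)
  refine (hκ.mul hs).congr_deriv ?_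
  unfold ff uuSlope kappa
  split_ifs <;> ring

lemma integrableOn_ff_mul {v : ℝ × ℝ → ℝ} (hv : Continuous v) :
    IntegrableOn (fun p => ff p.1 p.2 * v p) (Set.Icc 0 1 ×ˢ Set.Icc 0 1) := by
  have hc {g : ℝ × ℝ → ℝ} (hg : Continuous g) :
      IntegrableOn g (Set.Icc (0 : ℝ) 1 ×ˢ Set.Icc (0 : ℝ) 1) :=
    hg.continuousOn.integrableOn_compact (isCompact_Icc.prod isCompact_Icc)
  have hm : MeasurableSet {p : ℝ × ℝ | p.1 ≤ 1/2} :=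
    measurableSet_le measurable_fst measurable_const
  refine Integrable.congr (Integrable.piecewise hm
    (hc (g := fun p => (-2 - 6 * p.1 ^ 2 - 2 * p.2 ^ 2) * v p) (by fun_prop)).integrableOn
    (hc (g := fun p => (6 * p.1 ^ 2 + 2 * p.2 ^ 2 - 4 * p.1 + 2) * v p)
      (by fun_prop)).integrableOn) (.of_forall fun p => ?_)
  simp only [Set.piecewise, Set.mem_ofPred_eq, ff, ite_mul]

lemma intervalIntegrable_ff_mul {w : ℝ → ℝ} (hw : Continuous w) (y a b : ℝ) :
    IntervalIntegrable (fun x => ff x y * w x) volume a b := by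
  have hm : MeasurableSet {x : ℝ | x ≤ 1/2} := measurableSet_Iic
  have hc {g : ℝ → ℝ} (hg : Continuous g) : IntegrableOn g (Set.uIoc a b) :=
    intervalIntegrable_iff.1 (hg.intervalIntegrable a b)
  rw [intervalIntegrable_iff]
  refine Integrable.congr (Integrable.piecewise hm
    (hc (g := fun x => (-2 - 6 * x ^ 2 - 2 * y ^ 2) * w x) (by fun_prop)).integrableOn
    (hc (g := fun x => (6 * x ^ 2 + 2 * y ^ 2 - 4 * x + 2) * w x)
      (by fun_prop)).integrableOn) (.of_forall fun x => ?_)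
  simp only [Set.piecewise, Set.mem_ofPred_eq, ff, ite_mul]

/-- One-dimensional weak formulation on a horizontal slice. -/
lemma integral_flux_mul_deriv_sub {w w' : ℝ → ℝ} (hw : ∀ x, HasDerivAt w (w' x) x)
    (hw' : Continuous w') (h0 : w 0 = 0) (h1 : w 1 = 0) (y : ℝ) :
    ∫ x in (0 : ℝ)..1, (kappa x y * uuSlope x * w' x - ff x y * w x) = 0 := by
  have hwc : Continuous w := continuous_iff_continuousAt.2 fun x => (hw x).continuousAt
  have hflux : Continuous fun x => kappa x y * uuSlope x := by
    have := continuous_uuSlope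
    unfold kappa
    fun_prop
  rw [integral_eq_of_hasDerivAt_off_countable (fun x => kappa x y * uuSlope x * w x)
    (fun x => kappa x y * uuSlope x * w' x - ff x y * w x)
    (Set.countable_singleton (1/2 : ℝ)) (hflux.mul hwc).continuousOn (fun x hx => ?_)
    (((hflux.mul hw').intervalIntegrable 0 1).sub (intervalIntegrable_ff_mul hwc y 0 1))]
  · simp [h0, h1]
  · exact ((hasDerivAt_flux hx.2 y).mul (hw x)).congr_deriv (by ring)

/-- `u` is a weak solution of the Darcy equation `−∇·(κ∇u) = f` on `Ω`:
`u` is continuously differentiable on `ℝ²`, its gradient is `(2x, 0)` for `x ≤ 1/2` and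
`(2 − 2x, 0)` for `x > 1/2`, and for every smooth, compactly supported test function `v`
supported in `Ω` one has `∫_Ω κ ∇u·∇v = ∫_Ω f v`. -/
theorem uu_is_weak_solution :
    ContDiff ℝ 1 (fun p : ℝ × ℝ => uu p.1 p.2) ∧
      (∀ x y : ℝ,
        fderiv ℝ (fun p : ℝ × ℝ => uu p.1 p.2) (x, y) (1, 0)
            = (if x ≤ 1/2 then 2 * x else 2 - 2 * x) ∧
          fderiv ℝ (fun p : ℝ × ℝ => uu p.1 p.2) (x, y) (0, 1) = 0) ∧
      ∀ v : ℝ × ℝ → ℝ, ContDiff ℝ (⊤ : ℕ∞) v → HasCompactSupport v → tsupport v ⊆ OmegaSet →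
        ∫ p in OmegaSet,
            kappa p.1 p.2 *
              (fderiv ℝ (fun q : ℝ × ℝ => uu q.1 q.2) p (1, 0) * fderiv ℝ v p (1, 0) +
                fderiv ℝ (fun q : ℝ × ℝ => uu q.1 q.2) p (0, 1) * fderiv ℝ v p (0, 1))
          = ∫ p in OmegaSet, ff p.1 p.2 * v p := by
  have h10 (p : ℝ × ℝ) : fderiv ℝ (fun q : ℝ × ℝ => uu q.1 q.2) p (1, 0) = uuSlope p.1 := by
    simp [(hasFDerivAt_uu p).fderiv]
  have h01 (p : ℝ × ℝ) : fderiv ℝ (fun q : ℝ × ℝ => uu q.1 q.2) p (0, 1) = 0 := by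
    simp [(hasFDerivAt_uu p).fderiv]
  refine ⟨contDiff_uu, fun x y => ⟨h10 _, h01 _⟩, fun v hv _ hsupp => ?_⟩
  have hvx : Continuous fun p => fderiv ℝ v p (1, 0) :=
    (hv.continuous_fderiv (by simp)).clm_apply continuous_const
  have hslope := continuous_uuSlope
  have hsub : OmegaSet ⊆ Set.Icc 0 1 ×ˢ Set.Icc 0 1 :=
    Set.prod_mono Set.Ioo_subset_Icc_self Set.Ioo_subset_Icc_self
  have hA : IntegrableOn (fun p : ℝ × ℝ => kappa p.1 p.2 * uuSlope p.1 * fderiv ℝ v p (1, 0))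
      OmegaSet := by
    refine IntegrableOn.mono_set (ContinuousOn.integrableOn_compact
      (isCompact_Icc.prod isCompact_Icc) (Continuous.continuousOn ?_)) hsub
    unfold kappa
    fun_prop
  have hB := (integrableOn_ff_mul hv.continuous).mono_set hsub
  have hzero {p : ℝ × ℝ} (hp : p ∉ OmegaSet) : v p = 0 :=
    image_eq_zero_of_notMem_tsupport fun h => hp (hsupp h)
  simp only [h10, h01, zero_mul, add_zero, ← mul_assoc]
  rw [← sub_eq_zero, ← integral_sub hA hB]
  have hAB := hA.sub hB
  unfold OmegaSet IntegrableOn at hAB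
  unfold OmegaSet
  rw [Measure.volume_eq_prod, ← Measure.prod_restrict] at hAB ⊢
  refine (integral_prod_symm _ hAB).trans ?_
  refine integral_eq_zero_of_ae (.of_forall fun y => ?_)
  have hslice (x : ℝ) : HasDerivAt (fun t => v (t, y)) (fderiv ℝ v (x, y) (1, 0)) x :=
    ((hv.differentiable (by simp)) (x, y)).hasFDerivAt.comp_hasDerivAt x
      ((hasDerivAt_id x).prodMk (hasDerivAt_const x y))
  simp only [Pi.sub_apply, Pi.zero_apply]
  rw [← integral_Ioc_eq_integral_Ioo, ← intervalIntegral.integral_of_le zero_le_one]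
  exact integral_flux_mul_deriv_sub hslice (hvx.comp (by fun_prop))
    (hzero (by simp [OmegaSet])) (hzero (by simp [OmegaSet])) y
end

section
/- The Darcy problem admits no strong solution: there is no function w : Ω → ℝ that is twice continuously differentiable on Ω and satisfies −κ(x,y)·Δw(x,y) − ∇κ(x,y)·∇w(x,y) = f(x,y) at every point (x,y) ∈ Ω (i.e., −∇·(κ∇w) = f pointwise on Ω). -/
/-- The derivative of a horizontal slice is the directional derivative along `(1, 0)`. -/
theorem deriv_slice_fst {g : ℝ × ℝ → ℝ} {p : ℝ × ℝ} (hg : DifferentiableAt ℝ g p) :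
    deriv (fun s : ℝ => g (s, p.2)) p.1 = fderiv ℝ g p (1, 0) :=
  (HasFDerivAt.comp_hasDerivAt (f := fun s : ℝ => (s, p.2)) p.1 hg.hasFDerivAt
    ((hasDerivAt_id p.1).prodMk (hasDerivAt_const p.1 p.2))).deriv

/-- The derivative of a vertical slice is the directional derivative along `(0, 1)`. -/
theorem deriv_slice_snd {g : ℝ × ℝ → ℝ} {p : ℝ × ℝ} (hg : DifferentiableAt ℝ g p) :
    deriv (fun t : ℝ => g (p.1, t)) p.2 = fderiv ℝ g p (0, 1) :=
  (HasFDerivAt.comp_hasDerivAt (f := fun t : ℝ => (p.1, t)) p.2 hg.hasFDerivAt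
    ((hasDerivAt_const p.2 p.1).prodMk (hasDerivAt_id p.2))).deriv

/-- Directional derivatives of a `C²` function on an open set are `C¹`. -/
theorem contDiffOn_fderiv_apply {w : ℝ × ℝ → ℝ} {U : Set (ℝ × ℝ)} (hU : IsOpen U)
    (hw : ContDiffOn ℝ 2 w U) (v : ℝ × ℝ) :
    ContDiffOn ℝ 1 (fun q => fderiv ℝ w q v) U :=
  (hw.fderiv_of_isOpen hU (by norm_num)).clm_apply contDiffOn_const

/-- The second derivative of a horizontal slice of a `C²` function. -/
theorem deriv_deriv_slice_fst {w : ℝ × ℝ → ℝ} {U : Set (ℝ × ℝ)} (hU : IsOpen U)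
    (hw : ContDiffOn ℝ 2 w U) {p : ℝ × ℝ} (hp : p ∈ U) :
    deriv (deriv (fun s : ℝ => w (s, p.2))) p.1 =
      fderiv ℝ (fun q => fderiv ℝ w q (1, 0)) p (1, 0) := by
  have hev : ∀ᶠ s in nhds p.1, (s, p.2) ∈ U :=
    ContinuousAt.eventually_mem (f := fun s : ℝ => (s, p.2)) (by fun_prop) (hU.mem_nhds hp)
  have h : deriv (fun s : ℝ => w (s, p.2)) =ᶠ[nhds p.1]
      fun s => fderiv ℝ w (s, p.2) (1, 0) := by
    filter_upwards [hev] with s hs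
    exact deriv_slice_fst (p := (s, p.2))
      ((hw.differentiableOn (by norm_num)).differentiableAt (hU.mem_nhds hs))
  rw [h.deriv_eq]
  exact deriv_slice_fst (((contDiffOn_fderiv_apply hU hw (1, 0)).differentiableOn
    (by norm_num)).differentiableAt (hU.mem_nhds hp))

/-- The second derivative of a vertical slice of a `C²` function. -/
theorem deriv_deriv_slice_snd {w : ℝ × ℝ → ℝ} {U : Set (ℝ × ℝ)} (hU : IsOpen U)
    (hw : ContDiffOn ℝ 2 w U) {p : ℝ × ℝ} (hp : p ∈ U) :
    deriv (deriv (fun t : ℝ => w (p.1, t))) p.2 =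
      fderiv ℝ (fun q => fderiv ℝ w q (0, 1)) p (0, 1) := by
  have hev : ∀ᶠ t in nhds p.2, (p.1, t) ∈ U :=
    ContinuousAt.eventually_mem (f := fun t : ℝ => (p.1, t)) (by fun_prop) (hU.mem_nhds hp)
  have h : deriv (fun t : ℝ => w (p.1, t)) =ᶠ[nhds p.2]
      fun t => fderiv ℝ w (p.1, t) (0, 1) := by
    filter_upwards [hev] with t ht
    exact deriv_slice_snd (p := (p.1, t))
      ((hw.differentiableOn (by norm_num)).differentiableAt (hU.mem_nhds ht))
  rw [h.deriv_eq]
  exact deriv_slice_snd (((contDiffOn_fderiv_apply hU hw (0, 1)).differentiableOn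
    (by norm_num)).differentiableAt (hU.mem_nhds hp))

/-- The source jumps across the line `x = 1/2`. -/
theorem not_continuousAt_ff :
    ¬ ContinuousAt (fun p : ℝ × ℝ => ff p.1 p.2) (1 / 2, 1 / 2) := by
  intro h
  have hline : ContinuousAt (fun x : ℝ => ff x (1 / 2)) (1 / 2) :=
    ContinuousAt.comp (f := fun x : ℝ => (x, (1 / 2 : ℝ))) h (by fun_prop)
  have hvalue : Filter.Tendsto (fun x : ℝ => ff x (1 / 2)) (nhdsWithin (1 / 2) (Set.Ioi (1 / 2)))
      (nhds (ff (1 / 2) (1 / 2))) := hline.tendsto.mono_left nhdsWithin_le_nhds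
  have hpoly : ContinuousAt (fun x : ℝ => 6 * x ^ 2 + 2 * (1 / 2 : ℝ) ^ 2 - 4 * x + 2) (1 / 2) := by
    fun_prop
  have hright := (hpoly.tendsto.mono_left
    (nhdsWithin_le_nhds (s := Set.Ioi (1 / 2)))).congr' (f₂ := fun x : ℝ => ff x (1 / 2)) (by
      filter_upwards [self_mem_nhdsWithin] with x hx
      exact (if_neg (not_le.mpr hx)).symm)
  have := tendsto_nhds_unique hvalue hright
  norm_num [ff] at this

/-- The Darcy problem admits no strong solution: there is no `w` twice
continuously differentiable on `Ω` with
`−κ Δw − ∇κ·∇w = f` (i.e. `−∇·(κ∇w) = f`, where `∇κ = (2x, 2y)`) at every point of `Ω`. -/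
theorem no_strong_solution :
    ¬ ∃ w : ℝ × ℝ → ℝ, ContDiffOn ℝ 2 w OmegaSet ∧
      ∀ p ∈ OmegaSet,
        -kappa p.1 p.2 *
              (deriv (deriv (fun s : ℝ => w (s, p.2))) p.1 +
                deriv (deriv (fun t : ℝ => w (p.1, t))) p.2)
            - (2 * p.1 * deriv (fun s : ℝ => w (s, p.2)) p.1 +
                2 * p.2 * deriv (fun t : ℝ => w (p.1, t)) p.2)
          = ff p.1 p.2 := by
  rintro ⟨w, hw, heq⟩
  have ho : IsOpen OmegaSet := isOpen_Ioo.prod isOpen_Ioo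
  have hmem : ((1 / 2, 1 / 2) : ℝ × ℝ) ∈ OmegaSet := by
    constructor <;> constructor <;> norm_num
  have hd : DifferentiableOn ℝ w OmegaSet := hw.differentiableOn (by norm_num)
  have hx := contDiffOn_fderiv_apply ho hw (1, 0)
  have hy := contDiffOn_fderiv_apply ho hw (0, 1)
  have hxx := hx.continuousOn_fderiv_of_isOpen ho le_rfl
  have hyy := hy.continuousOn_fderiv_of_isOpen ho le_rfl
  have hcont : ContinuousOn (fun p : ℝ × ℝ => ff p.1 p.2) OmegaSet := by
    have hF : ContinuousOn (fun p : ℝ × ℝ =>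
        -(1 + p.1 ^ 2 + p.2 ^ 2) *
            (fderiv ℝ (fun q => fderiv ℝ w q (1, 0)) p (1, 0) +
              fderiv ℝ (fun q => fderiv ℝ w q (0, 1)) p (0, 1))
          - (2 * p.1 * fderiv ℝ w p (1, 0) + 2 * p.2 * fderiv ℝ w p (0, 1))) OmegaSet := by
      have h1 := hx.continuousOn
      have h2 := hy.continuousOn
      have h3 := hxx.clm_apply (continuousOn_const (c := ((1, 0) : ℝ × ℝ)))
      have h4 := hyy.clm_apply (continuousOn_const (c := ((0, 1) : ℝ × ℝ)))
      fun_prop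
    refine hF.congr fun p hp => ?_
    have hdp := hd.differentiableAt (ho.mem_nhds hp)
    simp only [← heq p hp, kappa]
    rw [deriv_deriv_slice_fst ho hw hp, deriv_deriv_slice_snd ho hw hp,
      deriv_slice_fst hdp, deriv_slice_snd hdp]
  exact not_continuousAt_ff (hcont.continuousAt (ho.mem_nhds hmem))
end
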